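/- In the vertex-coloured game with infinitely many colours, Breaker can even force infinitely many colour classes to be completely avoided: let c : ℕ → ℕ be a colouring of the vertices such that every colour class c⁻¹(i) is infinite. Then Breaker has a valid strategy such that in every play following it, for every infinite set W ⊆ ℕ all of whose edges are among Maker's claimed edges, the set of colours i ∈ ℕ with W ∩ c⁻¹(i) = ∅ is infinite; in particular Maker cannot obtain a K^{ℵ₀} containing vertices of all but finitely many colours. -/

import Mathlib

/-- The board: edges of the complete graph on ℕ, i.e. unordered pairs of
distinct natural numbers. -/
abbrev Edge := {e : Sym2 ℕ // ¬ e.IsDiag}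

/-- The interleaved sequence of moves M 0, B 0, M 1, B 1, … . -/
def interleave (M B : ℕ → Edge) (n : ℕ) : Edge :=
  if n % 2 = 0 then M (n / 2) else B (n / 2)

/-- A play of the game: all the moves M 0, B 0, M 1, B 1, … are pairwise distinct. -/
def IsPlay (M B : ℕ → Edge) : Prop :=
  Function.Injective (interleave M B)

/-- The history M 0, B 0, …, M (n-1), B (n-1) seen by Maker before her n-th move. -/
def histM (M B : ℕ → Edge) : ℕ → List Edge
  | 0 => []
  | n + 1 => histM M B n ++ [M n, B n]

/-- The history M 0, B 0, …, M n seen by Breaker before his n-th move. -/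
def histB (M B : ℕ → Edge) (n : ℕ) : List Edge :=
  histM M B n ++ [M n]

/-- A strategy is valid if it never names an already claimed edge. -/
def ValidStrat (σ : List Edge → Edge) : Prop :=
  ∀ h, σ h ∉ h

/-- The play (M, B) follows the Maker strategy σ. -/
def FollowsMaker (σ : List Edge → Edge) (M B : ℕ → Edge) : Prop :=
  ∀ n, M n = σ (histM M B n)

/-- The play (M, B) follows the Breaker strategy τ. -/
def FollowsBreaker (τ : List Edge → Edge) (M B : ℕ → Edge) : Prop :=
  ∀ n, B n = τ (histB M B n)

/-- Every edge with both endpoints in W is among Maker's claimed edges. -/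
def BuildsClique (M : ℕ → Edge) (W : Set ℕ) : Prop :=
  ∀ u ∈ W, ∀ v ∈ W, u ≠ v → ∃ n, (M n : Sym2 ℕ) = s(u, v)

def pairOf (k : ℕ) : Sym2 ℕ := s((Nat.unpair (Nat.unpair k).2).1, (Nat.unpair (Nat.unpair k).2).2)

def RespRel (c : ℕ → ℕ) (e e' : Edge) : Prop :=
  ∃ x a b : ℕ, a < x ∧ b < x ∧ pairOf (c x) = s(a, b) ∧ (e : Sym2 ℕ) = s(x, a) ∧
    (e' : Sym2 ℕ) = s(x, b)

theorem respRel_unique (c : ℕ → ℕ) (e e₁ e₂ : Edge) (h₁ : RespRel c e e₁)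
    (h₂ : RespRel c e e₂) : e₁ = e₂ := by
  obtain ⟨x, a, b, ha, hb, hp, he, he'⟩ := h₁
  obtain ⟨y, a', b', ha', hb', hp', hf, hf'⟩ := h₂
  rw [he, Sym2.eq_iff] at hf
  have hxy : x = y ∧ a = a' := by omega
  obtain ⟨rfl, rfl⟩ := hxy
  rw [hp, Sym2.eq_iff] at hp'
  have : b = b' := by omega
  subst this
  exact Subtype.ext (he'.trans hf'.symm)

theorem exists_fresh (h : List Edge) : ∃ e : Edge, e ∉ h := by
  have hinf : Infinite Edge := by
    refine Infinite.of_injective (fun n : ℕ => (⟨s(0, n + 1), by simp⟩ : Edge)) ?_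
    intro m n hmn
    have := congrArg Subtype.val hmn
    simp only [Sym2.eq_iff] at this
    omega
  classical
  obtain ⟨e, he⟩ := Infinite.exists_notMem_finset h.toFinset
  exact ⟨e, by simpa using he⟩

theorem exists_reply (c : ℕ → ℕ) (h : List Edge) : ∃ e' : Edge, e' ∉ h ∧
    ∀ e d : Edge, h.getLast? = some e → RespRel c e d → d ∉ h → e' = d := by
  by_cases hd : ∃ e d : Edge, h.getLast? = some e ∧ RespRel c e d ∧ d ∉ h
  · obtain ⟨e, d, h1, h2, h3⟩ := hd
    refine ⟨d, h3, fun e₁ d₁ g1 g2 _ => ?_⟩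
    rw [h1] at g1
    cases g1
    exact respRel_unique c e d d₁ h2 g2
  · obtain ⟨e', he'⟩ := exists_fresh h
    exact ⟨e', he', fun e d h1 h2 h3 => (hd ⟨e, d, h1, h2, h3⟩).elim⟩

theorem mem_histM (M B : ℕ → Edge) (n : ℕ) (e : Edge) (he : e ∈ histM M B n) :
    ∃ j < n, e = M j ∨ e = B j := by
  induction n with
  | zero => simp [histM] at he
  | succ n ih =>
    simp only [histM, List.mem_append, List.mem_cons, List.not_mem_nil, or_false] at he
    rcases he with he | he
    · obtain ⟨j, hj, h⟩ := ih he
      exact ⟨j, by omega, h⟩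
    · exact ⟨n, by omega, he⟩

theorem play_M_inj {M B : ℕ → Edge} (h : IsPlay M B) {m n : ℕ} (e : M m = M n) : m = n := by
  have := @h (2 * m) (2 * n) (by simp [interleave, e])
  omega

theorem play_M_ne_B {M B : ℕ → Edge} (h : IsPlay M B) (m n : ℕ) : M m ≠ B n := by
  intro e
  have h1 : (2 * n + 1) / 2 = n := by omega
  have := @h (2 * m) (2 * n + 1) (by simp [interleave, e, h1])
  omega

theorem no_later (c : ℕ → ℕ) {τ : List Edge → Edge}
    (hτ : ∀ h : List Edge, ∀ e d : Edge, h.getLast? = some e → RespRel c e d → d ∉ h → τ h = d)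
    {M B : ℕ → Edge} (hp : IsPlay M B) (hf : FollowsBreaker τ M B) {m n : ℕ}
    (hmn : n < m) (hr : RespRel c (M n) (M m)) : False := by
  have hB : B n = M m := by
    rw [hf n]
    refine hτ _ (M n) (M m) (by simp [histB]) hr ?_
    intro hmem
    simp only [histB, List.mem_append, List.mem_singleton] at hmem
    rcases hmem with hmem | hmem
    · obtain ⟨j, hj, h | h⟩ := mem_histM M B n _ hmem
      · have := play_M_inj hp h
        omega
      · exact play_M_ne_B hp _ _ h
    · have := play_M_inj hp hmem
      omega
  exact play_M_ne_B hp _ _ hB.symm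

/-- In the vertex-coloured game with infinitely many colours (every colour class
infinite), Breaker can force that any K^{ℵ₀} of Maker completely avoids
infinitely many colour classes. -/
theorem breaker_forces_infinitely_many_missed_colours (c : ℕ → ℕ)
    (hc : ∀ i : ℕ, (c ⁻¹' {i}).Infinite) :
    ∃ τ : List Edge → Edge, ValidStrat τ ∧
      ∀ M B : ℕ → Edge, IsPlay M B → FollowsBreaker τ M B →
        ∀ W : Set ℕ, W.Infinite → BuildsClique M W →
          {i : ℕ | W ∩ c ⁻¹' {i} = ∅}.Infinite := by
  choose τ hv hτ using exists_reply c
  refine ⟨τ, hv, ?_⟩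
  intro M B hp hf W hW hK
  obtain ⟨u, hu⟩ := hW.nonempty
  obtain ⟨v, hvW, huv⟩ := hW.exists_gt u
  have hinf : (Set.range fun j : ℕ => Nat.pair j (Nat.pair u v)).Infinite := by
    apply Set.infinite_range_of_injective
    intro i j hij
    exact (Nat.pair_eq_pair.mp hij).1
  have hfin : (c '' Set.Iic v).Finite := (Set.finite_Iic v).image c
  refine (hinf.sdiff hfin).mono ?_
  rintro _ ⟨⟨j, rfl⟩, hj⟩
  simp only [Set.mem_ofPred_eq]
  rw [Set.eq_empty_iff_forall_notMem]
  rintro x ⟨hx, hcx⟩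
  simp only [Set.mem_preimage, Set.mem_singleton_iff] at hcx
  have hxv : v < x := by
    by_contra hlt
    exact hj ⟨x, by simpa using hlt, hcx⟩
  have hpair : pairOf (c x) = s(u, v) := by simp [pairOf, hcx]
  obtain ⟨n, hn⟩ := hK x hx u hu (by omega)
  obtain ⟨m, hm⟩ := hK x hx v hvW (by omega)
  rcases lt_trichotomy n m with h | h | h
  · exact no_later c hτ hp hf h ⟨x, u, v, by omega, hxv, hpair, hn, hm⟩
  · subst h
    rw [hn, Sym2.eq_iff] at hm
    omega
  · exact no_later c hτ hp hf h ⟨x, v, u, hxv, by omega, hpair.trans Sym2.eq_swap, hm, hn⟩
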